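/- arXiv:1908.02457 — 3 statements merged into one kernel-verified Lean document; each statement's English description precedes it below -/
import Mathlib

section
/- Consider the SOS model on the Cayley tree of order 2 with a translation-invariant external field, i.e., α(x) = α for all x ∈ V with a constant α ∈ ℝ. If α ≠ 0, then every ground state φ is translation-invariant, i.e., φ is a constant configuration. -/
/-- Vertices of the Cayley tree of order 2: reduced words over a three-letter
alphabet, i.e. finite lists over `Fin 3` with no two consecutive letters equal. -/
def CayleyVertex : Type := {l : List (Fin 3) // l.Chain' (· ≠ ·)}

/-- Two vertices are adjacent iff one word is obtained from the other by
appending a single letter. -/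
def CayleyAdj (x y : CayleyVertex) : Prop :=
  (∃ a : Fin 3, x.val = a :: y.val) ∨ (∃ a : Fin 3, y.val = a :: x.val)

/-- The energy of the configuration `σ` on the unit ball centered at `x`:
`U_x(σ) = -(J/2) · Σ_{y ~ x} |σ(y) − σ(x)| + α(x)·σ(x)`. -/
noncomputable def ballEnergy (J : ℝ) (α : CayleyVertex → ℝ)
    (σ : CayleyVertex → Fin 3) (x : CayleyVertex) : ℝ :=
  -(J / 2) * ∑ᶠ y ∈ {y | CayleyAdj x y}, |((σ y : ℕ) : ℝ) - ((σ x : ℕ) : ℝ)|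
    + α x * ((σ x : ℕ) : ℝ)

/-- A configuration `φ` is a ground state if `U_x(φ) ≤ U_y(ψ)` for all
vertices `x, y` and all configurations `ψ`. -/
def IsGroundState (J : ℝ) (α : CayleyVertex → ℝ) (φ : CayleyVertex → Fin 3) : Prop :=
  ∀ (x y : CayleyVertex) (ψ : CayleyVertex → Fin 3),
    ballEnergy J α φ x ≤ ballEnergy J α ψ y

/-- Two configurations with the same absolute spin differences to the center `x` have the same
energy at `x` up to the field term. -/
theorem ballEnergy_sub_field_congr (J : ℝ) (α : CayleyVertex → ℝ)
    {φ ψ : CayleyVertex → Fin 3} {x : CayleyVertex}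
    (hd : ∀ y, |((ψ y : ℕ) : ℝ) - ((ψ x : ℕ) : ℝ)| = |((φ y : ℕ) : ℝ) - ((φ x : ℕ) : ℝ)|) :
    ballEnergy J α ψ x - α x * ((ψ x : ℕ) : ℝ) = ballEnergy J α φ x - α x * ((φ x : ℕ) : ℝ) := by
  simp only [ballEnergy, hd, add_sub_cancel_right]

/-- Every difference of two spins is realized with the second spin equal to `0`. -/
theorem exists_spin_dist_zero (s : Fin 3) : ∃ f : Fin 3 → Fin 3, f s = 0 ∧
    ∀ t, |((f t : ℕ) : ℝ) - ((f s : ℕ) : ℝ)| = |((t : ℕ) : ℝ) - ((s : ℕ) : ℝ)| := by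
  refine ⟨fun t => max t s - min t s, by simp, fun t => ?_⟩
  fin_cases s <;> fin_cases t <;> norm_num [Fin.sub_def, abs_of_nonneg, abs_of_neg]

/-- Every difference of two spins is realized with the second spin equal to `2`. -/
theorem exists_spin_dist_two (s : Fin 3) : ∃ f : Fin 3 → Fin 3, f s = 2 ∧
    ∀ t, |((f t : ℕ) : ℝ) - ((f s : ℕ) : ℝ)| = |((t : ℕ) : ℝ) - ((s : ℕ) : ℝ)| := by
  refine ⟨fun t => 2 - (max t s - min t s), by simp, fun t => ?_⟩
  fin_cases s <;> fin_cases t <;> norm_num [Fin.sub_def, abs_of_nonneg, abs_of_neg]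

/-- In a ground state, the field term at a vertex cannot be lowered by moving the center spin
while keeping all spin differences to it. -/
theorem IsGroundState.field_le {J a : ℝ} {φ : CayleyVertex → Fin 3}
    (h : IsGroundState J (fun _ => a) φ) (x : CayleyVertex) {f : Fin 3 → Fin 3}
    (hf : ∀ t, |((f t : ℕ) : ℝ) - ((f (φ x) : ℕ) : ℝ)| = |((t : ℕ) : ℝ) - ((φ x : ℕ) : ℝ)|) :
    a * ((φ x : ℕ) : ℝ) ≤ a * ((f (φ x) : ℕ) : ℝ) := by
  have h₁ := ballEnergy_sub_field_congr J (fun _ => a) (φ := φ) (ψ := fun y => f (φ y)) (x := x)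
    fun y => hf (φ y)
  have h₂ := h x x fun y => f (φ y)
  linarith

/-- For the SOS model with a non-zero translation-invariant external field, every
ground state is translation invariant, i.e. a constant configuration. -/
theorem groundState_translation_invariant_of_constant_nonzero_field
    (J a : ℝ) (ha : a ≠ 0) (φ : CayleyVertex → Fin 3)
    (h : IsGroundState J (fun _ => a) φ) :
    ∃ c : Fin 3, ∀ x : CayleyVertex, φ x = c := by
  rcases lt_or_gt_of_ne ha with ha | ha
  · refine ⟨2, fun x => ?_⟩
    obtain ⟨f, hfx, hf⟩ := exists_spin_dist_two (φ x)
    have hle := h.field_le x hf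
    rw [hfx, mul_le_mul_left_of_neg ha] at hle
    have hle' : ((2 : Fin 3) : ℕ) ≤ (φ x : ℕ) := by exact_mod_cast hle
    exact le_antisymm (Fin.le_last _) (Fin.le_def.2 hle')
  · refine ⟨0, fun x => ?_⟩
    obtain ⟨f, hfx, hf⟩ := exists_spin_dist_zero (φ x)
    have hle := h.field_le x hf
    rw [hfx, mul_le_mul_iff_right₀ ha] at hle
    have hle' : (φ x : ℕ) ≤ ((0 : Fin 3) : ℕ) := by exact_mod_cast hle
    exact le_antisymm (Fin.le_def.2 hle') (Fin.zero_le _)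
end

section
/- Consider the SOS model on the Cayley tree of order 2 with translation-invariant external field α(x) = α for all x. If J < 0 and α < 0, then the set of ground states is exactly the one-element set consisting of the constant configuration σ(x) = 2 for all x ∈ V; that is, a configuration φ is a ground state if and only if φ(x) = 2 for all x ∈ V. -/
theorem le_ballEnergy {J : ℝ} (hJ : J ≤ 0) (α : CayleyVertex → ℝ)
    (σ : CayleyVertex → Fin 3) (x : CayleyVertex) :
    α x * ((σ x : ℕ) : ℝ) ≤ ballEnergy J α σ x := by
  have h : 0 ≤ ∑ᶠ y ∈ {y | CayleyAdj x y}, |((σ y : ℕ) : ℝ) - ((σ x : ℕ) : ℝ)| :=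
    finsum_nonneg fun _ => finsum_nonneg fun _ => abs_nonneg _
  have h' := mul_nonneg (by linarith : 0 ≤ -(J / 2)) h
  unfold ballEnergy
  linarith

theorem ballEnergy_of_forall_eq (J : ℝ) (α : CayleyVertex → ℝ)
    {σ : CayleyVertex → Fin 3} {c : Fin 3} (h : ∀ x, σ x = c) (x : CayleyVertex) :
    ballEnergy J α σ x = α x * ((c : ℕ) : ℝ) := by
  simp [ballEnergy, h]

/-- If `J < 0` and `α < 0`, then the set of ground states for the SOS model with
translation-invariant external field `α` is exactly `{σ ≡ 2}`. -/
theorem groundState_iff_constant_two (J a : ℝ) (hJ : J < 0) (ha : a < 0)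
    (φ : CayleyVertex → Fin 3) :
    IsGroundState J (fun _ => a) φ ↔ ∀ x : CayleyVertex, φ x = 2 := by
  constructor
  · intro h x
    have h₁ := (le_ballEnergy hJ.le (fun _ => a) φ x).trans (h x x fun _ => 2)
    rw [ballEnergy_of_forall_eq J _ (fun _ => rfl)] at h₁
    have h₂ : (((2 : Fin 3) : ℕ) : ℝ) ≤ ((φ x : ℕ) : ℝ) :=
      (mul_le_mul_left_of_neg ha).mp h₁
    have h₃ : (2 : Fin 3) ≤ φ x := by exact_mod_cast h₂
    exact le_antisymm (Fin.le_last _) h₃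
  · intro h x y ψ
    rw [ballEnergy_of_forall_eq J _ h]
    refine le_trans ?_ (le_ballEnergy hJ.le _ ψ y)
    refine mul_le_mul_of_nonpos_left ?_ ha.le
    exact_mod_cast Fin.le_last (ψ y)
end

section
/- Consider the SOS model on the Cayley tree of order 2 with the period-two external field α(x) = α₁ for x of even word length and α(x) = α₂ for x of odd word length. If J ≥ 0, α₁ ≥ 0 and α₂ = 0, then the G₂⁽²⁾-periodic configuration σ with σ(x) = 0 for x of even word length and σ(x) = 2 for x of odd word length is a ground state. -/
/-- The letter `a` acts on words by cancelling a leading `a`, or else by prepending `a`. -/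
def letterStep (a : Fin 3) : List (Fin 3) → List (Fin 3)
  | [] => [a]
  | b :: l => if a = b then l else a :: b :: l

theorem isChain_letterStep (a : Fin 3) {l : List (Fin 3)} (hl : l.IsChain (· ≠ ·)) :
    (letterStep a l).IsChain (· ≠ ·) := by
  cases l with
  | nil => simp [letterStep]
  | cons b l =>
    rw [letterStep]
    split_ifs with h
    · exact hl.tail
    · exact List.isChain_cons_cons.2 ⟨h, hl⟩

theorem letterStep_left_injective (l : List (Fin 3)) :
    Function.Injective fun a => letterStep a l := by
  intro a b h
  have hlen := congrArg List.length h
  cases l with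
  | nil => simpa [letterStep] using h
  | cons c l =>
    simp only [letterStep] at h hlen
    grind

/-- The neighbor of `x` in the direction of the letter `a`. -/
def cayleyNeighbor (x : CayleyVertex) (a : Fin 3) : CayleyVertex :=
  ⟨letterStep a x.val, isChain_letterStep a x.property⟩

theorem cayleyNeighbor_injective (x : CayleyVertex) :
    Function.Injective (cayleyNeighbor x) := fun _ _ h =>
  letterStep_left_injective x.val (congrArg Subtype.val h)

theorem range_cayleyNeighbor (x : CayleyVertex) :
    Set.range (cayleyNeighbor x) = {y | CayleyAdj x y} := by
  ext y
  constructor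
  · rintro ⟨a, rfl⟩
    rcases x with ⟨_ | ⟨b, l⟩, hx⟩
    · exact Or.inr ⟨a, rfl⟩
    · by_cases h : a = b
      · exact Or.inl ⟨a, by simp [cayleyNeighbor, letterStep, h]⟩
      · exact Or.inr ⟨a, by simp [cayleyNeighbor, letterStep, h]⟩
  · rintro (⟨a, h⟩ | ⟨a, h⟩)
    · exact ⟨a, Subtype.ext (by simp [cayleyNeighbor, letterStep, h])⟩
    · refine ⟨a, Subtype.ext ?_⟩
      have hy : (a :: x.val).IsChain (· ≠ ·) := h ▸ y.property
      rw [h]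
      rcases x with ⟨_ | ⟨b, l⟩, hx⟩
      · rfl
      · simp [cayleyNeighbor, letterStep, (List.isChain_cons_cons.1 hy).1]

theorem CayleyAdj.even_length_iff {x y : CayleyVertex} (h : CayleyAdj x y) :
    Even y.val.length ↔ ¬ Even x.val.length := by
  rcases h with ⟨a, h⟩ | ⟨a, h⟩ <;> simp [h, Nat.even_add_one]

theorem cayleyAdj_cayleyNeighbor (x : CayleyVertex) (a : Fin 3) :
    CayleyAdj x (cayleyNeighbor x a) :=
  (range_cayleyNeighbor x).subset ⟨a, rfl⟩

theorem ballEnergy_eq_sum (J : ℝ) (α : CayleyVertex → ℝ) (σ : CayleyVertex → Fin 3)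
    (x : CayleyVertex) :
    ballEnergy J α σ x =
      -(J / 2) * ∑ a, |((σ (cayleyNeighbor x a) : ℕ) : ℝ) - ((σ x : ℕ) : ℝ)|
        + α x * ((σ x : ℕ) : ℝ) := by
  rw [ballEnergy, ← range_cayleyNeighbor, finsum_mem_range (cayleyNeighbor_injective x),
    finsum_eq_sum_of_fintype]

theorem abs_spin_sub_le_two (i j : Fin 3) : |((i : ℕ) : ℝ) - ((j : ℕ) : ℝ)| ≤ 2 := by
  fin_cases i <;> fin_cases j <;> norm_num

/-- For `J ≥ 0` and a nonnegative field, every ball energy is at least `-3 * J`. -/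
theorem neg_three_mul_le_ballEnergy {J : ℝ} (hJ : 0 ≤ J) {α : CayleyVertex → ℝ}
    (σ : CayleyVertex → Fin 3) (x : CayleyVertex) (hα : 0 ≤ α x) :
    -3 * J ≤ ballEnergy J α σ x := by
  rw [ballEnergy_eq_sum]
  have hsum : ∑ a, |((σ (cayleyNeighbor x a) : ℕ) : ℝ) - ((σ x : ℕ) : ℝ)| ≤ 6 :=
    (Finset.sum_le_sum fun a _ => abs_spin_sub_le_two _ _).trans (by norm_num)
  have hfield : 0 ≤ α x * ((σ x : ℕ) : ℝ) := by positivity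
  nlinarith [mul_le_mul_of_nonneg_left hsum hJ]

/-- For `J ≥ 0`, `α₁ ≥ 0`, `α₂ = 0`, the `G₂⁽²⁾`-periodic configuration which is `0`
on even words and `2` on odd words is a ground state of the SOS model with the
period-two external field (`α₁` on even words, `α₂` on odd words). -/
theorem periodic_zero_two_isGroundState (J α₁ α₂ : ℝ)
    (hJ : 0 ≤ J) (h1 : 0 ≤ α₁) (h2 : α₂ = 0) :
    IsGroundState J (fun x => if Even x.val.length then α₁ else α₂)
      (fun x => if Even x.val.length then 0 else 2) := by
  intro x y ψ
  refine le_trans (le_of_eq ?_) (neg_three_mul_le_ballEnergy hJ ψ y ?_)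
  · rw [ballEnergy_eq_sum]
    simp only [(cayleyAdj_cayleyNeighbor x _).even_length_iff]
    by_cases hx : Even x.val.length <;> simp [hx, h2] <;> ring
  · split_ifs
    exacts [h1, h2.ge]
end
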